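/- Let μ^k, ν^k ∈ P_r(ℝ) (k ∈ ℕ) be in convex order with W_r(μ^k, μ) → 0 and W_r(ν^k, ν) → 0, and let π ∈ Π_M(μ, ν) be a martingale coupling. If there exist martingale couplings π^k ∈ Π_M(μ^k, ν^k) with AW_1(π^k, π) → 0, then also AW_r(π^k, π) → 0. -/

import Mathlib

open MeasureTheory

/-- `W_r^r(μ,ν) = inf { ∫ d(x,y)^r dπ : π ∈ Π(μ,ν) }`. -/
noncomputable def WrRpow {X : Type*} [MetricSpace X] [MeasurableSpace X]
    (r : ℝ) (μ ν : Measure X) : ℝ :=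
  sInf {c : ℝ | ∃ π : Measure (X × X), π.map Prod.fst = μ ∧ π.map Prod.snd = ν ∧
    c = ∫ p, dist p.1 p.2 ^ r ∂π}

/-- `AW_r^r(π, π') = inf_{χ ∈ Π(μ, μ')} ∫ (|x - x'|^r + W_r^r(π_x, π'_{x'})) dχ`. -/
noncomputable def AWrRpow (r : ℝ) (π π' : Measure (ℝ × ℝ))
    [IsFiniteMeasure π] [IsFiniteMeasure π'] : ℝ :=
  sInf {c : ℝ | ∃ χ : Measure (ℝ × ℝ),
    χ.map Prod.fst = π.map Prod.fst ∧ χ.map Prod.snd = π'.map Prod.fst ∧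
    c = ∫ q, (|q.1 - q.2| ^ r + WrRpow r (π.condKernel q.1) (π'.condKernel q.2)) ∂χ}

open MeasureTheory ProbabilityTheory Set Filter Topology
open scoped ENNReal

/-- Quantile function on `(0,1)`, extended by zero. -/
noncomputable def qf (p : Measure ℝ) (u : ℝ) : ℝ :=
  open Classical in if u ∈ Ioo (0 : ℝ) 1 then sInf {y : ℝ | u ≤ cdf p y} else 0

/-- Uniform measure on `(0,1)`. -/
noncomputable def unif : Measure ℝ := volume.restrict (Ioo (0 : ℝ) 1)

instance : IsProbabilityMeasure unif := ⟨by simp [unif]⟩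

lemma qf_le_iff (p : Measure ℝ) {u : ℝ} (hu : u ∈ Ioo (0 : ℝ) 1) (t : ℝ) :
    qf p u ≤ t ↔ u ≤ cdf p t := by
  have hne : {y : ℝ | u ≤ cdf p y}.Nonempty := by
    have := (tendsto_cdf_atTop p).eventually (eventually_gt_nhds hu.2)
    obtain ⟨y, hy⟩ := this.exists
    exact ⟨y, hy.le⟩
  have hbdd : BddBelow {y : ℝ | u ≤ cdf p y} := by
    have := (tendsto_cdf_atBot p).eventually (eventually_lt_nhds hu.1)
    obtain ⟨y, hy⟩ := this.exists
    refine ⟨y, fun z hz => ?_⟩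
    by_contra h
    push Not at h
    have h1 := (monotone_cdf p) h.le
    have hz' : u ≤ cdf p z := hz
    linarith
  rw [qf, if_pos hu]
  constructor
  · intro h
    have hgt : ∀ s, t < s → u ≤ cdf p s := by
      intro s hs
      obtain ⟨y, hy, hys⟩ := exists_lt_of_csInf_lt hne (lt_of_le_of_lt h hs)
      exact le_trans hy (monotone_cdf p hys.le)
    have hc : Tendsto (cdf p) (𝓝[>] t) (𝓝 (cdf p t)) :=
      ((cdf p).right_continuous t).mono_left (nhdsWithin_mono _ Ioi_subset_Ici_self)
    refine ge_of_tendsto hc ?_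
    filter_upwards [self_mem_nhdsWithin] with s hs using hgt s hs
  · intro h
    exact csInf_le hbdd h

lemma measurable_qf {Ω : Type*} [MeasurableSpace Ω] (κ : Kernel ℝ ℝ) [IsMarkovKernel κ]
    {g : Ω → ℝ} (hg : Measurable g) :
    Measurable (fun z : Ω × ℝ => qf (κ (g z.1)) z.2) := by
  refine measurable_of_Iic fun t => ?_
  have : (fun z : Ω × ℝ => qf (κ (g z.1)) z.2) ⁻¹' Iic t =
      ({z | z.2 ∈ Ioo (0 : ℝ) 1} ∩ {z | z.2 ≤ cdf (κ (g z.1)) t}) ∪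
      ({z | z.2 ∈ Ioo (0 : ℝ) 1}ᶜ ∩ {_z | (0 : ℝ) ≤ t}) := by
    ext z
    by_cases hz : z.2 ∈ Ioo (0 : ℝ) 1
    · have := qf_le_iff (κ (g z.1)) hz t
      simp only [mem_preimage, mem_Iic, this]
      simp only [mem_union, mem_inter_iff, mem_ofPred_eq, mem_compl_iff, hz]
      simp
    · have : qf (κ (g z.1)) z.2 = 0 := by rw [qf, if_neg hz]
      simp only [mem_preimage, mem_Iic, this]
      simp only [mem_union, mem_inter_iff, mem_ofPred_eq, mem_compl_iff, hz]
      simp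
  rw [this]
  have h1 : MeasurableSet {z : Ω × ℝ | z.2 ∈ Ioo (0 : ℝ) 1} := measurable_snd measurableSet_Ioo
  have hF : Measurable (fun z : Ω × ℝ => cdf (κ (g z.1)) t) := by
    have : (fun z : Ω × ℝ => cdf (κ (g z.1)) t) = fun z => (κ (g z.1) (Iic t)).toReal := by
      ext z; rw [cdf_eq_real]; rfl
    rw [this]
    exact ((κ.measurable_coe measurableSet_Iic).comp (hg.comp measurable_fst)).ennreal_toReal
  exact (h1.inter (measurableSet_le measurable_snd hF)).union (h1.compl.inter (MeasurableSet.const _))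

lemma measurable_qf' (p : Measure ℝ) [IsProbabilityMeasure p] : Measurable (qf p) := by
  have := measurable_qf (Ω := ℝ) (Kernel.const ℝ p) measurable_id
  exact this.comp (measurable_const (a := (0 : ℝ)) |>.prodMk measurable_id)

lemma map_qf (p : Measure ℝ) [IsProbabilityMeasure p] : unif.map (qf p) = p := by
  have : IsProbabilityMeasure (unif.map (qf p)) :=
    Measure.isProbabilityMeasure_map (measurable_qf' p).aemeasurable
  refine Measure.ext_of_Iic _ _ fun t => ?_
  rw [Measure.map_apply (measurable_qf' p) measurableSet_Iic, unif,
    Measure.restrict_apply (measurable_qf' p measurableSet_Iic)]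
  have hae : (qf p ⁻¹' Iic t ∩ Ioo 0 1 : Set ℝ) = Iic (cdf p t) ∩ Ioo 0 1 := by
    ext u
    simp only [mem_inter_iff, mem_preimage, mem_Iic]
    constructor
    · rintro ⟨h, hu⟩; exact ⟨(qf_le_iff p hu t).1 h, hu⟩
    · rintro ⟨h, hu⟩; exact ⟨(qf_le_iff p hu t).2 h, hu⟩
  rw [hae, ← ofReal_cdf p t]
  have h0 := cdf_nonneg p t
  have h1 := cdf_le_one p t
  apply le_antisymm
  · calc volume (Iic (cdf p t) ∩ Ioo 0 1) ≤ volume (Ioc 0 (cdf p t)) := measure_mono (fun u hu => And.intro hu.2.1 hu.1)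
      _ = _ := by simp
  · calc _ = volume (Ioo 0 (cdf p t)) := by simp
      _ ≤ volume (Iic (cdf p t) ∩ Ioo 0 1) := measure_mono fun u hu => ⟨hu.2.le, hu.1, hu.2.trans_le h1⟩

/-- Coupling by quantiles. -/
noncomputable def qc (p q : Measure ℝ) : Measure (ℝ × ℝ) := unif.map (fun u => (qf p u, qf q u))

lemma enorm_eq_vol (a b : ℝ) : ‖a - b‖ₑ = volume {t : ℝ | min a b ≤ t ∧ t < max a b} := by
  have : {t : ℝ | min a b ≤ t ∧ t < max a b} = Ico (min a b) (max a b) := rfl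
  rw [this, Real.volume_Ico, max_sub_min_eq_abs, Real.enorm_eq_ofReal_abs, abs_sub_comm]

lemma cost_eq (γ : Measure (ℝ × ℝ)) [IsFiniteMeasure γ] :
    ∫⁻ z, ‖z.1 - z.2‖ₑ ∂γ = ∫⁻ t : ℝ, γ {z | min z.1 z.2 ≤ t ∧ t < max z.1 z.2} := by
  have hS : MeasurableSet {w : (ℝ × ℝ) × ℝ | min w.1.1 w.1.2 ≤ w.2 ∧ w.2 < max w.1.1 w.1.2} :=
    by
    refine MeasurableSet.inter (s₁ := {w : (ℝ × ℝ) × ℝ | min w.1.1 w.1.2 ≤ w.2})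
      (s₂ := {w : (ℝ × ℝ) × ℝ | w.2 < max w.1.1 w.1.2}) ?_ ?_
    · exact measurableSet_le (by fun_prop) (by fun_prop)
    · exact measurableSet_lt (by fun_prop) (by fun_prop)
  have h1 := Measure.prod_apply (μ := γ) (ν := (volume : Measure ℝ)) hS
  rw [Measure.prod_apply_symm hS] at h1
  simp_rw [enorm_eq_vol]
  exact h1.symm

lemma qc_opt (p q : Measure ℝ) [IsProbabilityMeasure p] [IsProbabilityMeasure q]
    (γ : Measure (ℝ × ℝ)) [IsFiniteMeasure γ] (h1 : γ.map Prod.fst = p) (h2 : γ.map Prod.snd = q) :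
    ∫⁻ u, ‖qf p u - qf q u‖ₑ ∂unif ≤ ∫⁻ z, ‖z.1 - z.2‖ₑ ∂γ := by
  have hm : Measurable (fun u => (qf p u, qf q u)) := (measurable_qf' p).prodMk (measurable_qf' q)
  have e : ∫⁻ u, ‖qf p u - qf q u‖ₑ ∂unif = ∫⁻ z, ‖z.1 - z.2‖ₑ ∂(qc p q) := by
    rw [qc, lintegral_map (by fun_prop) hm]
  have : IsProbabilityMeasure (qc p q) := Measure.isProbabilityMeasure_map hm.aemeasurable
  rw [e, cost_eq, cost_eq]
  refine lintegral_mono fun t => ?_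
  have hSm : MeasurableSet {z : ℝ × ℝ | min z.1 z.2 ≤ t ∧ t < max z.1 z.2} :=
    by
    refine MeasurableSet.inter (s₁ := {z : ℝ × ℝ | min z.1 z.2 ≤ t})
      (s₂ := {z : ℝ × ℝ | t < max z.1 z.2}) ?_ ?_
    · exact measurableSet_le (by fun_prop) (by fun_prop)
    · exact measurableSet_lt (by fun_prop) (by fun_prop)
  have hup : qc p q {z | min z.1 z.2 ≤ t ∧ t < max z.1 z.2} ≤ ENNReal.ofReal |cdf p t - cdf q t| := by
    rw [qc, Measure.map_apply hm hSm, unif, Measure.restrict_apply (hm hSm)]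
    calc _ ≤ volume (Ioc (min (cdf p t) (cdf q t)) (max (cdf p t) (cdf q t))) := by
          refine measure_mono fun u hu => ?_
          obtain ⟨⟨ha, hb⟩, hu⟩ := hu
          simp only [min_le_iff, lt_max_iff] at ha hb
          rw [qf_le_iff p hu, qf_le_iff q hu] at ha
          rw [← not_le, ← not_le, qf_le_iff p hu, qf_le_iff q hu, not_le, not_le] at hb
          exact ⟨min_lt_iff.2 hb, le_max_iff.2 ha⟩
      _ = _ := by rw [Real.volume_Ioc, max_sub_min_eq_abs, abs_sub_comm]
  refine hup.trans ?_
  have key : ∀ s, MeasurableSet s → γ (Prod.fst ⁻¹' s) = p s ∧ γ (Prod.snd ⁻¹' s) = q s := by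
    intro s hs
    rw [← h1, ← h2, Measure.map_apply measurable_fst hs, Measure.map_apply measurable_snd hs]
    exact ⟨rfl, rfl⟩
  obtain ⟨k1, k2⟩ := key (Iic t) measurableSet_Iic
  set A := γ {z | min z.1 z.2 ≤ t ∧ t < max z.1 z.2} with hA
  have b1 : p (Iic t) ≤ q (Iic t) + A := by
    rw [← k1, ← k2]
    refine (measure_mono ?_).trans (measure_union_le _ _)
    intro z hz
    by_cases hz2 : z.2 ≤ t
    · left; exact hz2
    · right; exact ⟨min_le_of_left_le hz, lt_max_of_lt_right (not_le.1 hz2)⟩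
  have b2 : q (Iic t) ≤ p (Iic t) + A := by
    rw [← k1, ← k2]
    refine (measure_mono ?_).trans (measure_union_le _ _)
    intro z hz
    by_cases hz2 : z.1 ≤ t
    · left; exact hz2
    · right; exact ⟨min_le_of_right_le hz, lt_max_of_lt_left (not_le.1 hz2)⟩
  have hAf : A ≠ ∞ := measure_ne_top _ _
  rw [← ENNReal.ofReal_toReal hAf]
  apply ENNReal.ofReal_le_ofReal
  rw [cdf_eq_real, cdf_eq_real, abs_le, Measure.real, Measure.real]
  have c1 := ENNReal.toReal_mono (by finiteness) b1
  have c2 := ENNReal.toReal_mono (by finiteness) b2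
  rw [ENNReal.toReal_add (by finiteness) hAf] at c1 c2
  constructor <;> linarith

lemma qc_fst (p q : Measure ℝ) [IsProbabilityMeasure p] [IsProbabilityMeasure q] :
    (qc p q).map Prod.fst = p := by
  rw [qc, Measure.map_map measurable_fst ((measurable_qf' p).prodMk (measurable_qf' q))]
  exact map_qf p

lemma qc_snd (p q : Measure ℝ) [IsProbabilityMeasure p] [IsProbabilityMeasure q] :
    (qc p q).map Prod.snd = q := by
  rw [qc, Measure.map_map measurable_snd ((measurable_qf' p).prodMk (measurable_qf' q))]
  exact map_qf q

lemma enorm_rpow_eq (r : ℝ) (hr : 0 ≤ r) (x : ℝ) : ‖x‖ₑ ^ r = ENNReal.ofReal (|x| ^ r) := by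
  rw [Real.enorm_eq_ofReal_abs, ENNReal.ofReal_rpow_of_nonneg (abs_nonneg _) hr]

lemma WrRpow_bdd (r : ℝ) (p q : Measure ℝ) :
    BddBelow {c : ℝ | ∃ π : Measure (ℝ × ℝ), π.map Prod.fst = p ∧ π.map Prod.snd = q ∧
    c = ∫ p, dist p.1 p.2 ^ r ∂π} := by
  refine ⟨0, ?_⟩
  rintro c ⟨_, _, _, rfl⟩
  exact integral_nonneg fun _ => by positivity

lemma WrRpow_nonneg (r : ℝ) (p q : Measure ℝ) : 0 ≤ WrRpow r p q := by
  refine Real.sInf_nonneg ?_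
  rintro c ⟨_, _, _, rfl⟩
  exact integral_nonneg fun _ => by positivity

lemma integral_le_lint {α : Type*} [MeasurableSpace α] (m : Measure α) (f : α → ℝ) (hf : 0 ≤ f) :
    ∫ x, f x ∂m ≤ (∫⁻ x, ENNReal.ofReal (f x) ∂m).toReal := by
  by_cases h : AEStronglyMeasurable f m
  · rw [integral_eq_lintegral_of_nonneg_ae (ae_of_all _ hf) h]
  · rw [integral_undef (fun h' => h h'.1)]; exact ENNReal.toReal_nonneg

lemma Wr_le_q (r : ℝ) (hr : 0 ≤ r) (p q : Measure ℝ) [IsProbabilityMeasure p]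
    [IsProbabilityMeasure q] :
    ENNReal.ofReal (WrRpow r p q) ≤ ∫⁻ u, ‖qf p u - qf q u‖ₑ ^ r ∂unif := by
  have hm : Measurable (fun u => (qf p u, qf q u)) := (measurable_qf' p).prodMk (measurable_qf' q)
  have h1 : WrRpow r p q ≤ ∫ z, dist z.1 z.2 ^ r ∂(qc p q) :=
    csInf_le (WrRpow_bdd r p q) ⟨qc p q, qc_fst p q, qc_snd p q, rfl⟩
  have h2 := integral_le_lint (qc p q) (fun z => dist z.1 z.2 ^ r) (fun _ => by positivity)
  refine (ENNReal.ofReal_le_ofReal (h1.trans h2)).trans (ENNReal.ofReal_toReal_le.trans ?_)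
  rw [qc, lintegral_map (by fun_prop) hm]
  simp_rw [Real.dist_eq, enorm_rpow_eq r hr]
  exact le_rfl

lemma prob_of_fst {γ : Measure (ℝ × ℝ)} {p : Measure ℝ} [IsProbabilityMeasure p]
    (h : γ.map Prod.fst = p) : IsProbabilityMeasure γ := by
  constructor
  rw [← measure_univ (μ := p), ← h, Measure.map_apply measurable_fst MeasurableSet.univ]
  rfl

/-- moments of a coupling -/
lemma lint_marg {γ : Measure (ℝ × ℝ)} {p q : Measure ℝ}
    (h1 : γ.map Prod.fst = p) (h2 : γ.map Prod.snd = q) (f : ℝ → ℝ≥0∞) (hf : Measurable f) :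
    ∫⁻ z, f z.1 ∂γ = ∫⁻ x, f x ∂p ∧ ∫⁻ z, f z.2 ∂γ = ∫⁻ x, f x ∂q := by
  rw [← h1, ← h2, lintegral_map hf measurable_fst, lintegral_map hf measurable_snd]
  exact ⟨rfl, rfl⟩

lemma add_rpow_le (r : ℝ) (hr : 1 ≤ r) (a b : ℝ≥0∞) :
    (a + b) ^ r ≤ 2 ^ r * (a ^ r + b ^ r) := by
  refine (ENNReal.rpow_add_le_mul_rpow_add_rpow a b hr).trans ?_
  gcongr
  · exact one_le_two
  · linarith

lemma cost_fin (r : ℝ) (hr : 1 ≤ r) {γ : Measure (ℝ × ℝ)} {p q : Measure ℝ}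
    (h1 : γ.map Prod.fst = p) (h2 : γ.map Prod.snd = q)
    (hp : ∫⁻ x, ‖x‖ₑ ^ r ∂p ≠ ∞) (hq : ∫⁻ x, ‖x‖ₑ ^ r ∂q ≠ ∞) :
    ∫⁻ z, ‖z.1 - z.2‖ₑ ^ r ∂γ ≠ ∞ := by
  have hb : ∫⁻ z, ‖z.1 - z.2‖ₑ ^ r ∂γ ≤
      2 ^ r * (∫⁻ x, ‖x‖ₑ ^ r ∂p + ∫⁻ x, ‖x‖ₑ ^ r ∂q) := by
    obtain ⟨e1, e2⟩ := lint_marg h1 h2 (fun x => ‖x‖ₑ ^ r) (by fun_prop)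
    rw [← e1, ← e2, ← lintegral_add_left (by fun_prop), ← lintegral_const_mul _ (by fun_prop)]
    refine lintegral_mono fun z => ?_
    refine le_trans ?_ (add_rpow_le r hr _ _)
    gcongr
    exact enorm_sub_le
  refine ne_top_of_le_ne_top ?_ hb
  have : (2 : ℝ≥0∞) ^ r ≠ ∞ := ENNReal.rpow_ne_top_of_nonneg (by linarith) (by simp)
  exact ENNReal.mul_ne_top this (ENNReal.add_ne_top.2 ⟨hp, hq⟩)

/-- cost of a coupling as a Bochner integral -/
lemma cost_ofReal (r : ℝ) (hr : 0 ≤ r) {γ : Measure (ℝ × ℝ)}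
    (hfin : ∫⁻ z, ‖z.1 - z.2‖ₑ ^ r ∂γ ≠ ∞) :
    ENNReal.ofReal (∫ z, dist z.1 z.2 ^ r ∂γ) = ∫⁻ z, ‖z.1 - z.2‖ₑ ^ r ∂γ := by
  have hm : Measurable (fun z : ℝ × ℝ => dist z.1 z.2 ^ r) := by fun_prop
  rw [integral_eq_lintegral_of_nonneg_ae (ae_of_all _ fun _ => by positivity)
    hm.aestronglyMeasurable]
  simp_rw [Real.dist_eq, ← enorm_rpow_eq r hr]
  rw [ENNReal.ofReal_toReal hfin]

lemma exists_cpl (r : ℝ) (hr : 1 ≤ r) (p q : Measure ℝ) [IsProbabilityMeasure p]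
    [IsProbabilityMeasure q]
    (hp : ∫⁻ x, ‖x‖ₑ ^ r ∂p ≠ ∞) (hq : ∫⁻ x, ‖x‖ₑ ^ r ∂q ≠ ∞) {c : ℝ} (hc : WrRpow r p q < c) :
    ∃ γ : Measure (ℝ × ℝ), γ.map Prod.fst = p ∧ γ.map Prod.snd = q ∧
      ∫⁻ z, ‖z.1 - z.2‖ₑ ^ r ∂γ ≤ ENNReal.ofReal c := by
  obtain ⟨_, ⟨γ, h1, h2, rfl⟩, hlt⟩ := exists_lt_of_csInf_lt
    (s := {c : ℝ | ∃ π : Measure (ℝ × ℝ), π.map Prod.fst = p ∧ π.map Prod.snd = q ∧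
      c = ∫ p, dist p.1 p.2 ^ r ∂π})
    ⟨_, qc p q, qc_fst p q, qc_snd p q, rfl⟩ hc
  refine ⟨γ, h1, h2, ?_⟩
  rw [← cost_ofReal r (by linarith) (cost_fin r hr h1 h2 hp hq)]
  exact ENNReal.ofReal_le_ofReal hlt.le

lemma W1_eq (p q : Measure ℝ) [IsProbabilityMeasure p]
    [IsProbabilityMeasure q]
    (hp : ∫⁻ x, ‖x‖ₑ ∂p ≠ ∞) (hq : ∫⁻ x, ‖x‖ₑ ∂q ≠ ∞) :
    ENNReal.ofReal (WrRpow 1 p q) = ∫⁻ u, ‖qf p u - qf q u‖ₑ ∂unif := by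
  apply le_antisymm
  · simpa using Wr_le_q 1 zero_le_one p q
  · have : ∀ c, WrRpow 1 p q < c → ∫⁻ u, ‖qf p u - qf q u‖ₑ ∂unif ≤ ENNReal.ofReal c := by
      intro c hc
      obtain ⟨γ, h1, h2, h3⟩ := exists_cpl 1 le_rfl p q (by simpa using hp) (by simpa using hq) hc
      have := prob_of_fst h1
      simp only [ENNReal.rpow_one] at h3
      exact (qc_opt p q γ h1 h2).trans h3
    have hc : Tendsto (fun c => ENNReal.ofReal c) (𝓝[>] (WrRpow 1 p q))
        (𝓝 (ENNReal.ofReal (WrRpow 1 p q))) :=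
      ENNReal.continuous_ofReal.continuousAt.tendsto.mono_left nhdsWithin_le_nhds
    refine ge_of_tendsto hc ?_
    filter_upwards [self_mem_nhdsWithin] with c hc using this c hc

/-- law of the quantile draw -/
lemma map_draw {Ω : Type*} [MeasurableSpace Ω] (χ : Measure Ω) [IsFiniteMeasure χ]
    (ρ : Measure (ℝ × ℝ)) [IsProbabilityMeasure ρ] {g : Ω → ℝ} (hg : Measurable g)
    (h : χ.map g = ρ.map Prod.fst) :
    (χ.prod unif).map (fun z => qf (ρ.condKernel (g z.1)) z.2) = ρ.map Prod.snd := by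
  ext s hs
  have hm := measurable_qf ρ.condKernel hg
  rw [Measure.map_apply hm hs, Measure.prod_apply (hm hs)]
  have e1 : ∀ x, unif (Prod.mk x ⁻¹' ((fun z : Ω × ℝ => qf (ρ.condKernel (g z.1)) z.2) ⁻¹' s))
      = ρ.condKernel (g x) s := by
    intro x
    conv_rhs => rw [← map_qf (ρ.condKernel (g x)), Measure.map_apply (measurable_qf' _) hs]
    rfl
  simp_rw [e1]
  have e2 : ∫⁻ x, ρ.condKernel (g x) s ∂χ = ∫⁻ x, ρ.condKernel x s ∂(χ.map g) := by
    rw [lintegral_map (ρ.condKernel.measurable_coe hs) hg]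
  rw [e2, h]
  have e3 : ρ.map Prod.snd s = (ρ.fst ⊗ₘ ρ.condKernel) (Prod.snd ⁻¹' s) := by
    rw [Measure.map_apply measurable_snd hs, ρ.disintegrate]
  rw [e3, Measure.compProd_apply (measurable_snd hs)]
  rfl

/-- excess over R -/
noncomputable def exc (R : ℝ) (y : ℝ) : ℝ := max (|y| - R) 0

lemma meas_exc (R : ℝ) : Measurable (exc R) := by unfold exc; fun_prop

lemma exc_tendsto (r : ℝ) (hr : 1 ≤ r) (ν : Measure ℝ) (hν : ∫⁻ x, ‖x‖ₑ ^ r ∂ν ≠ ∞) :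
    Tendsto (fun n : ℕ => ∫⁻ y, ‖exc n y‖ₑ ^ r ∂ν) atTop (𝓝 0) := by
  have := tendsto_lintegral_of_dominated_convergence (μ := ν)
    (F := fun (n : ℕ) y => ‖exc n y‖ₑ ^ r) (f := fun _ => 0) (fun y => ‖y‖ₑ ^ r)
    (fun n => by have := meas_exc n; fun_prop) ?_ hν ?_
  · simpa using this
  · intro n
    refine ae_of_all _ fun y => ?_
    simp only
    gcongr
    rw [Real.enorm_eq_ofReal_abs, Real.enorm_eq_ofReal_abs]
    apply ENNReal.ofReal_le_ofReal
    rw [exc, abs_of_nonneg (le_max_right _ _)]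
    exact max_le (by have : (0 : ℝ) ≤ n := by positivity
                     linarith) (abs_nonneg _)
  · refine ae_of_all _ fun y => ?_
    obtain ⟨N, hN⟩ := exists_nat_ge |y|
    apply tendsto_const_nhds.congr'
    filter_upwards [eventually_ge_atTop N] with n hn
    have : (N : ℝ) ≤ n := by exact_mod_cast hn
    have e : exc n y = 0 := by rw [exc, max_eq_right]; linarith
    rw [e, enorm_zero, ENNReal.zero_rpow_of_pos (by linarith)]

lemma exc_nonneg (R y : ℝ) : 0 ≤ exc R y := le_max_right _ _

lemma exc_lip (R a b : ℝ) : exc R a ≤ exc R b + |a - b| := by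
  unfold exc
  have h1 : |a| - |b| ≤ |a - b| := abs_sub_abs_le_abs_sub a b
  have := le_max_left (|b| - R) 0
  have h3 := le_max_right (|b| - R) 0
  exact max_le (by linarith) (by positivity)

/-- pointwise estimate -/
lemma pt_bound (R : ℝ) (hR : 0 ≤ R) (a b : ℝ) :
    |a - b| ≤ exc R a + exc R b + min |a - b| (2 * R) := by
  unfold exc
  have h1 := le_max_left (|a| - R) 0
  have h2 := le_max_left (|b| - R) 0
  have h3 := le_max_right (|a| - R) 0
  have h4 := le_max_right (|b| - R) 0
  rcases le_total |a - b| (2 * R) with h | h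
  · rw [min_eq_left h]; linarith
  · rw [min_eq_right h]
    have := abs_sub a b
    linarith

lemma min_rpow (r : ℝ) (hr : 1 ≤ r) (t S : ℝ) (ht : 0 ≤ t) (hS : 0 ≤ S) :
    (min t S) ^ r ≤ S ^ (r - 1) * t := by
  have h0 : 0 ≤ min t S := le_min ht hS
  have : (min t S) ^ r = (min t S) ^ (r - 1) * min t S := by
    rcases h0.eq_or_lt with h | h
    · rw [← h, mul_zero, Real.zero_rpow (by linarith)]
    · rw [← Real.rpow_add_one h.ne']; congr 1; ring
  rw [this]
  have := min_le_left t S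
  have := min_le_right t S
  gcongr

lemma core_bound (r : ℝ) (hr : 1 ≤ r) (p q : Measure ℝ) (γ θ : Measure (ℝ × ℝ))
    (g1 : γ.map Prod.fst = p) (g2 : γ.map Prod.snd = q)
    (t1 : θ.map Prod.fst = p) (t2 : θ.map Prod.snd = q) (R : ℝ) (hR : 0 ≤ R) :
    ∫⁻ z, ‖z.1 - z.2‖ₑ ^ r ∂θ ≤ 2 ^ r * (2 ^ r * (2 ^ r * (∫⁻ y, ‖exc R y‖ₑ ^ r ∂q +
      ∫⁻ z, ‖z.1 - z.2‖ₑ ^ r ∂γ) + ∫⁻ y, ‖exc R y‖ₑ ^ r ∂q) +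
      ENNReal.ofReal ((2 * R) ^ (r - 1)) * ∫⁻ z, ‖z.1 - z.2‖ₑ ∂θ) := by
  have hexc := meas_exc R
  have hf : Measurable (fun y => ‖exc R y‖ₑ ^ r) := by fun_prop
  obtain ⟨e1, e2⟩ := lint_marg g1 g2 _ hf
  obtain ⟨e3, e4⟩ := lint_marg t1 t2 _ hf
  have hp : ∫⁻ y, ‖exc R y‖ₑ ^ r ∂p ≤ 2 ^ r * (∫⁻ y, ‖exc R y‖ₑ ^ r ∂q +
      ∫⁻ z, ‖z.1 - z.2‖ₑ ^ r ∂γ) := by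
    rw [← e1, ← e2, ← lintegral_add_left (by fun_prop), ← lintegral_const_mul _ (by fun_prop)]
    refine lintegral_mono fun z => ?_
    refine le_trans ?_ (add_rpow_le r hr _ _)
    gcongr
    simp only [Real.enorm_eq_ofReal_abs]
    rw [← ENNReal.ofReal_add (abs_nonneg _) (abs_nonneg _)]
    apply ENNReal.ofReal_le_ofReal
    have := exc_lip R z.1 z.2
    rw [abs_of_nonneg (exc_nonneg R z.1),
      abs_of_nonneg (exc_nonneg R z.2)]
    exact this
  calc ∫⁻ z, ‖z.1 - z.2‖ₑ ^ r ∂θ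
      ≤ ∫⁻ z, 2 ^ r * (2 ^ r * (‖exc R z.1‖ₑ ^ r + ‖exc R z.2‖ₑ ^ r) +
        ENNReal.ofReal ((2 * R) ^ (r - 1)) * ‖z.1 - z.2‖ₑ) ∂θ := by
        refine lintegral_mono fun z => ?_
        have hz : ‖z.1 - z.2‖ₑ ≤ (‖exc R z.1‖ₑ + ‖exc R z.2‖ₑ) + ‖min |z.1 - z.2| (2 * R)‖ₑ := by
          have := pt_bound R hR z.1 z.2
          simp only [Real.enorm_eq_ofReal_abs]
          rw [← ENNReal.ofReal_add (abs_nonneg _) (abs_nonneg _),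
            ← ENNReal.ofReal_add (by positivity) (abs_nonneg _)]
          apply ENNReal.ofReal_le_ofReal
          refine this.trans ?_
          gcongr <;> exact le_abs_self _
        have hmin : ‖min |z.1 - z.2| (2 * R)‖ₑ ^ r ≤
            ENNReal.ofReal ((2 * R) ^ (r - 1)) * ‖z.1 - z.2‖ₑ := by
          rw [enorm_rpow_eq r (by linarith), Real.enorm_eq_ofReal_abs,
            ← ENNReal.ofReal_mul (by positivity)]
          apply ENNReal.ofReal_le_ofReal
          rw [abs_of_nonneg (le_min (abs_nonneg _) (by positivity))]
          exact min_rpow r hr _ _ (abs_nonneg _) (by positivity)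
        calc _ ≤ ((‖exc R z.1‖ₑ + ‖exc R z.2‖ₑ) + ‖min |z.1 - z.2| (2 * R)‖ₑ) ^ r := by gcongr
          _ ≤ _ := add_rpow_le r hr _ _
          _ ≤ _ := by
            gcongr
            exact add_rpow_le r hr _ _
    _ = 2 ^ r * (2 ^ r * (∫⁻ y, ‖exc R y‖ₑ ^ r ∂p + ∫⁻ y, ‖exc R y‖ₑ ^ r ∂q) +
      ENNReal.ofReal ((2 * R) ^ (r - 1)) * ∫⁻ z, ‖z.1 - z.2‖ₑ ∂θ) := by
        rw [← e3, ← e4]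
        rw [lintegral_const_mul _ (by fun_prop), lintegral_add_left (by fun_prop),
          lintegral_const_mul _ (by fun_prop), lintegral_add_left (by fun_prop),
          lintegral_const_mul _ (by fun_prop)]
    _ ≤ _ := by gcongr

lemma core (r : ℝ) (hr : 1 ≤ r) (p : ℕ → Measure ℝ) (q : Measure ℝ)
    (hq : ∫⁻ x, ‖x‖ₑ ^ r ∂q ≠ ∞) (γ θ : ℕ → Measure (ℝ × ℝ))
    (g1 : ∀ k, (γ k).map Prod.fst = p k) (g2 : ∀ k, (γ k).map Prod.snd = q)
    (t1 : ∀ k, (θ k).map Prod.fst = p k) (t2 : ∀ k, (θ k).map Prod.snd = q)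
    (hγ : Tendsto (fun k => ∫⁻ z, ‖z.1 - z.2‖ₑ ^ r ∂(γ k)) atTop (𝓝 0))
    (hθ : Tendsto (fun k => ∫⁻ z, ‖z.1 - z.2‖ₑ ∂(θ k)) atTop (𝓝 0)) :
    Tendsto (fun k => ∫⁻ z, ‖z.1 - z.2‖ₑ ^ r ∂(θ k)) atTop (𝓝 0) := by
  have h2 : (2 : ℝ≥0∞) ^ r ≠ ∞ := ENNReal.rpow_ne_top_of_nonneg (by linarith) (by simp)
  have hcm : ∀ (c : ℝ≥0∞), c ≠ ∞ → ∀ (f : ℕ → ℝ≥0∞) (l : ℝ≥0∞), Tendsto f atTop (𝓝 l) →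
      Tendsto (fun k => c * f k) atTop (𝓝 (c * l)) := fun c hc f l hf =>
    ENNReal.Tendsto.const_mul hf (Or.inr hc)
  have hlim : ∀ n : ℕ, Tendsto (fun k => 2 ^ r * (2 ^ r * (2 ^ r * (∫⁻ y, ‖exc n y‖ₑ ^ r ∂q +
      ∫⁻ z, ‖z.1 - z.2‖ₑ ^ r ∂(γ k)) + ∫⁻ y, ‖exc n y‖ₑ ^ r ∂q) +
      ENNReal.ofReal ((2 * (n : ℝ)) ^ (r - 1)) * ∫⁻ z, ‖z.1 - z.2‖ₑ ∂(θ k))) atTop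
      (𝓝 (2 ^ r * (2 ^ r * (2 ^ r * (∫⁻ y, ‖exc n y‖ₑ ^ r ∂q + 0) + ∫⁻ y, ‖exc n y‖ₑ ^ r ∂q) +
      ENNReal.ofReal ((2 * (n : ℝ)) ^ (r - 1)) * 0))) := by
    intro n
    exact hcm _ h2 _ _ ((hcm _ h2 _ _ ((hcm _ h2 _ _ (tendsto_const_nhds.add hγ)).add
      tendsto_const_nhds)).add (hcm _ ENNReal.ofReal_ne_top _ _ hθ))
  have hexc := exc_tendsto r hr q hq
  have hlim2 : Tendsto (fun n : ℕ => 2 ^ r * (2 ^ r * (2 ^ r * (∫⁻ y, ‖exc n y‖ₑ ^ r ∂q + 0) +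
      ∫⁻ y, ‖exc n y‖ₑ ^ r ∂q) + ENNReal.ofReal ((2 * (n : ℝ)) ^ (r - 1)) * 0)) atTop (𝓝 0) := by
    have := hcm _ h2 _ _ (hcm _ h2 _ _ ((hcm _ h2 _ _ hexc).add hexc))
    simpa using this
  rw [ENNReal.tendsto_nhds_zero]
  intro ε hε
  obtain ⟨n, hn⟩ := (hlim2.eventually (eventually_lt_nhds hε)).exists
  filter_upwards [(hlim n).eventually (eventually_lt_nhds hn)] with k hk
  exact (core_bound r hr _ _ _ _ (g1 k) (g2 k) (t1 k) (t2 k) n (by positivity)).trans hk.le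

lemma mom_fin (r : ℝ) (hr : 0 ≤ r) {p : Measure ℝ} (h : Integrable (fun x => |x| ^ r) p) :
    ∫⁻ x, ‖x‖ₑ ^ r ∂p ≠ ∞ := by
  simp_rw [enorm_rpow_eq r hr]
  exact (hasFiniteIntegral_iff_ofReal (ae_of_all _ fun x => by positivity)).1 h.2 |>.ne

lemma mom1_fin (r : ℝ) (hr : 1 ≤ r) {p : Measure ℝ} [IsProbabilityMeasure p]
    (h : ∫⁻ x, ‖x‖ₑ ^ r ∂p ≠ ∞) : ∫⁻ x, ‖x‖ₑ ∂p ≠ ∞ := by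
  have : ∫⁻ x, ‖x‖ₑ ∂p ≤ ∫⁻ x, (1 + ‖x‖ₑ ^ r) ∂p := by
    refine lintegral_mono fun x => ?_
    rcases le_total ‖x‖ₑ 1 with h | h
    · exact h.trans le_self_add
    · refine le_trans ?_ le_add_self
      conv_lhs => rw [← ENNReal.rpow_one ‖x‖ₑ]
      exact ENNReal.rpow_le_rpow_of_exponent_le h hr
  refine ne_top_of_le_ne_top ?_ this
  rw [lintegral_add_left (by fun_prop)]
  simpa using h

lemma exists_cpls (r : ℝ) (hr : 1 ≤ r) (p : ℕ → Measure ℝ) (q : Measure ℝ)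
    [∀ k, IsProbabilityMeasure (p k)] [IsProbabilityMeasure q]
    (hp : ∀ k, ∫⁻ x, ‖x‖ₑ ^ r ∂(p k) ≠ ∞) (hq : ∫⁻ x, ‖x‖ₑ ^ r ∂q ≠ ∞)
    (hW : Tendsto (fun k => (WrRpow r (p k) q) ^ (1 / r)) atTop (𝓝 0)) :
    ∃ γ : ℕ → Measure (ℝ × ℝ), (∀ k, (γ k).map Prod.fst = p k) ∧ (∀ k, (γ k).map Prod.snd = q) ∧
      Tendsto (fun k => ∫⁻ z, ‖z.1 - z.2‖ₑ ^ r ∂(γ k)) atTop (𝓝 0) := by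
  have hW' : Tendsto (fun k => WrRpow r (p k) q) atTop (𝓝 0) := by
    have := hW.rpow_const (p := r) (Or.inr (by linarith))
    rw [Real.zero_rpow (by linarith)] at this
    refine this.congr fun k => ?_
    rw [← Real.rpow_mul (WrRpow_nonneg _ _ _), one_div_mul_cancel (by linarith), Real.rpow_one]
  have := fun k : ℕ => exists_cpl r hr (p k) q (hp k) hq
    (c := WrRpow r (p k) q + 1 / ((k : ℝ) + 1)) (by have : (0 : ℝ) < 1 / ((k : ℝ) + 1) := by positivity
                                                    linarith)
  choose γ h1 h2 h3 using this
  refine ⟨γ, h1, h2, ?_⟩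
  refine tendsto_of_tendsto_of_tendsto_of_le_of_le tendsto_const_nhds ?_ (fun _ => zero_le) h3
  have := ENNReal.tendsto_ofReal (hW'.add tendsto_one_div_add_atTop_nhds_zero_nat)
  simpa using this

/-- joint law of the quantile draws -/
noncomputable def law (χ π π' : Measure (ℝ × ℝ)) [IsFiniteMeasure π] [IsFiniteMeasure π'] :
    Measure (ℝ × ℝ) :=
  (χ.prod unif).map (fun z => (qf (π.condKernel z.1.1) z.2, qf (π'.condKernel z.1.2) z.2))

section
variable (χ π π' : Measure (ℝ × ℝ)) [IsProbabilityMeasure π] [IsProbabilityMeasure π']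
    [IsProbabilityMeasure χ]

lemma meas_law : Measurable (fun z : (ℝ × ℝ) × ℝ =>
    (qf (π.condKernel z.1.1) z.2, qf (π'.condKernel z.1.2) z.2)) :=
  (measurable_qf π.condKernel measurable_fst).prodMk (measurable_qf π'.condKernel measurable_snd)

lemma law_fst (h1 : χ.map Prod.fst = π.map Prod.fst) :
    (law χ π π').map Prod.fst = π.map Prod.snd := by
  rw [law, Measure.map_map measurable_fst (meas_law π π')]
  exact map_draw χ π measurable_fst h1

lemma law_snd (h2 : χ.map Prod.snd = π'.map Prod.fst) :
    (law χ π π').map Prod.snd = π'.map Prod.snd := by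
  rw [law, Measure.map_map measurable_snd (meas_law π π')]
  exact map_draw χ π' measurable_snd h2

lemma law_cost (r : ℝ) : ∫⁻ z, ‖z.1 - z.2‖ₑ ^ r ∂(law χ π π') =
    ∫⁻ q, ∫⁻ u, ‖qf (π.condKernel q.1) u - qf (π'.condKernel q.2) u‖ₑ ^ r ∂unif ∂χ := by
  have hm := meas_law π π'
  rw [law, lintegral_map (by fun_prop) hm, lintegral_prod]
  exact ((by fun_prop : Measurable fun z : ℝ × ℝ => ‖z.1 - z.2‖ₑ ^ r).comp hm).aemeasurable

/-- upper bound -/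
lemma AW_le (r : ℝ) (hr : 0 ≤ r) (h1 : χ.map Prod.fst = π.map Prod.fst)
    (h2 : χ.map Prod.snd = π'.map Prod.fst) :
    ENNReal.ofReal (AWrRpow r π π') ≤
      ∫⁻ z, ‖z.1 - z.2‖ₑ ^ r ∂χ + ∫⁻ z, ‖z.1 - z.2‖ₑ ^ r ∂(law χ π π') := by
  have hnn : ∀ q : ℝ × ℝ,
      0 ≤ |q.1 - q.2| ^ r + WrRpow r (π.condKernel q.1) (π'.condKernel q.2) := fun q =>
    add_nonneg (by positivity) (WrRpow_nonneg _ _ _)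
  have hle : AWrRpow r π π' ≤
      ∫ q, (|q.1 - q.2| ^ r + WrRpow r (π.condKernel q.1) (π'.condKernel q.2)) ∂χ := by
    refine csInf_le ⟨0, ?_⟩ ⟨χ, h1, h2, rfl⟩
    rintro c ⟨χ', _, _, rfl⟩
    exact integral_nonneg fun q => add_nonneg (by positivity) (WrRpow_nonneg _ _ _)
  refine (ENNReal.ofReal_le_ofReal (hle.trans (integral_le_lint χ _ hnn))).trans
    (ENNReal.ofReal_toReal_le.trans ?_)
  rw [law_cost, ← lintegral_add_left (by fun_prop)]
  refine lintegral_mono fun q => ?_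
  rw [ENNReal.ofReal_add (by positivity) (WrRpow_nonneg _ _ _), enorm_rpow_eq r hr]
  gcongr
  exact Wr_le_q r hr _ _

lemma ae_mom (g : ℝ × ℝ → ℝ) (hg : Measurable g) (h : χ.map g = π.map Prod.fst)
    (hm : ∫⁻ x, ‖x‖ₑ ∂(π.map Prod.snd) ≠ ∞) :
    ∀ᵐ q ∂χ, ∫⁻ y, ‖y‖ₑ ∂(π.condKernel (g q)) ≠ ∞ := by
  have e : ∫⁻ q, ∫⁻ y, ‖y‖ₑ ∂(π.condKernel (g q)) ∂χ = ∫⁻ x, ‖x‖ₑ ∂(π.map Prod.snd) := by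
    rw [← map_draw χ π hg h, lintegral_map (by fun_prop) (measurable_qf _ hg), lintegral_prod]
    · refine lintegral_congr fun q => ?_
      conv_lhs => rw [← map_qf (π.condKernel (g q))]
      rw [lintegral_map (by fun_prop) (measurable_qf' _)]
    · exact (measurable_qf π.condKernel hg).enorm.aemeasurable
  have hmeas : Measurable fun q => ∫⁻ y, ‖y‖ₑ ∂(π.condKernel (g q)) :=
    (Measurable.lintegral_kernel (κ := π.condKernel) (by fun_prop)).comp hg
  filter_upwards [ae_lt_top hmeas (by rw [e]; exact hm)] with q hq using hq.ne

/-- exact cost for `r = 1` -/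
lemma AW1_cost (h1 : χ.map Prod.fst = π.map Prod.fst)
    (h2 : χ.map Prod.snd = π'.map Prod.fst)
    (m1 : ∫⁻ x, ‖x‖ₑ ∂(π.map Prod.fst) ≠ ∞) (m2 : ∫⁻ x, ‖x‖ₑ ∂(π'.map Prod.fst) ≠ ∞)
    (n1 : ∫⁻ x, ‖x‖ₑ ∂(π.map Prod.snd) ≠ ∞) (n2 : ∫⁻ x, ‖x‖ₑ ∂(π'.map Prod.snd) ≠ ∞) :
    ENNReal.ofReal (∫ q, (|q.1 - q.2| ^ (1 : ℝ) +
      WrRpow 1 (π.condKernel q.1) (π'.condKernel q.2)) ∂χ) =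
      ∫⁻ z, ‖z.1 - z.2‖ₑ ∂χ + ∫⁻ z, ‖z.1 - z.2‖ₑ ∂(law χ π π') := by
  have c1 := cost_fin 1 le_rfl h1 h2 (by simpa using m1) (by simpa using m2)
  have c2 := cost_fin 1 le_rfl (law_fst χ π π' h1) (law_snd χ π π' h2)
    (by simpa using n1) (by simpa using n2)
  have lc := law_cost χ π π' 1
  simp only [ENNReal.rpow_one] at c1 c2 lc
  have hae : ∀ᵐ q ∂χ, ENNReal.ofReal (WrRpow 1 (π.condKernel q.1) (π'.condKernel q.2)) =
      ∫⁻ u, ‖qf (π.condKernel q.1) u - qf (π'.condKernel q.2) u‖ₑ ∂unif := by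
    filter_upwards [ae_mom χ π _ measurable_fst h1 n1, ae_mom χ π' _ measurable_snd h2 n2]
      with q a b using W1_eq _ _ a b
  have hml : Measurable fun q : ℝ × ℝ =>
      ∫⁻ u, ‖qf (π.condKernel q.1) u - qf (π'.condKernel q.2) u‖ₑ ∂unif := by
    have hm := meas_law π π'
    exact ((by fun_prop : Measurable fun z : ℝ × ℝ => ‖z.1 - z.2‖ₑ).comp hm).lintegral_prod_right'
  have hW : AEMeasurable (fun q : ℝ × ℝ => WrRpow 1 (π.condKernel q.1) (π'.condKernel q.2)) χ := by
    refine ⟨_, hml.ennreal_toReal, ?_⟩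
    filter_upwards [hae] with q hq
    rw [← hq, ENNReal.toReal_ofReal (WrRpow_nonneg _ _ _)]
  have hnn : ∀ q : ℝ × ℝ,
      0 ≤ |q.1 - q.2| ^ (1 : ℝ) + WrRpow 1 (π.condKernel q.1) (π'.condKernel q.2) := fun q =>
    add_nonneg (by positivity) (WrRpow_nonneg _ _ _)
  have hF : AEMeasurable (fun q : ℝ × ℝ => |q.1 - q.2| ^ (1 : ℝ) +
      WrRpow 1 (π.condKernel q.1) (π'.condKernel q.2)) χ :=
    AEMeasurable.add (by fun_prop) hW
  have hl : ∫⁻ q, ENNReal.ofReal (|q.1 - q.2| ^ (1 : ℝ) +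
      WrRpow 1 (π.condKernel q.1) (π'.condKernel q.2)) ∂χ =
      ∫⁻ z, ‖z.1 - z.2‖ₑ ∂χ + ∫⁻ z, ‖z.1 - z.2‖ₑ ∂(law χ π π') := by
    rw [lc, ← lintegral_add_left (by fun_prop)]
    refine lintegral_congr_ae ?_
    filter_upwards [hae] with q hq
    rw [ENNReal.ofReal_add (by positivity) (WrRpow_nonneg _ _ _), hq, Real.rpow_one,
      Real.enorm_eq_ofReal_abs]
  rw [integral_eq_lintegral_of_nonneg_ae (ae_of_all _ hnn) hF.aestronglyMeasurable, hl,
    ENNReal.ofReal_toReal (ENNReal.add_ne_top.2 ⟨c1, c2⟩)]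

end

/-- If martingale couplings `π^k ∈ Π_M(μ^k, ν^k)` converge to `π ∈ Π_M(μ, ν)` in `AW_1`,
and the marginals converge in `W_r`, then `π^k → π` in `AW_r`. -/
theorem stmt18 (r : ℝ) (hr : 1 ≤ r)
    (μ ν : Measure ℝ) (μk νk : ℕ → Measure ℝ)
    [IsProbabilityMeasure μ] [IsProbabilityMeasure ν]
    [∀ k, IsProbabilityMeasure (μk k)] [∀ k, IsProbabilityMeasure (νk k)]
    (hmomμ : Integrable (fun x => |x| ^ r) μ) (hmomν : Integrable (fun x => |x| ^ r) ν)
    (hmomμk : ∀ k, Integrable (fun x => |x| ^ r) (μk k))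
    (hmomνk : ∀ k, Integrable (fun x => |x| ^ r) (νk k))
    (hcvx : ∀ k, ∀ f : ℝ → ℝ, ConvexOn ℝ Set.univ f →
      Integrable f (μk k) → Integrable f (νk k) →
      ∫ x, f x ∂(μk k) ≤ ∫ x, f x ∂(νk k))
    (hWμ : Filter.Tendsto (fun k => (WrRpow r (μk k) μ) ^ (1 / r)) Filter.atTop (nhds 0))
    (hWν : Filter.Tendsto (fun k => (WrRpow r (νk k) ν) ^ (1 / r)) Filter.atTop (nhds 0))
    (π : Measure (ℝ × ℝ)) [IsProbabilityMeasure π]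
    (hπ1 : π.map Prod.fst = μ) (hπ2 : π.map Prod.snd = ν)
    (hπmart : ∀ᵐ x ∂μ, ∫ y, y ∂(π.condKernel x) = x)
    (πk : ℕ → Measure (ℝ × ℝ)) [∀ k, IsProbabilityMeasure (πk k)]
    (hπk1 : ∀ k, (πk k).map Prod.fst = μk k) (hπk2 : ∀ k, (πk k).map Prod.snd = νk k)
    (hπkmart : ∀ k, ∀ᵐ x ∂(μk k), ∫ y, y ∂((πk k).condKernel x) = x)
    (hAW1 : Filter.Tendsto (fun k => AWrRpow 1 (πk k) π) Filter.atTop (nhds 0)) :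
    Filter.Tendsto (fun k => (AWrRpow r (πk k) π) ^ (1 / r)) Filter.atTop (nhds 0) := by
  have hr0 : 0 ≤ r := by linarith
  have Mμ := mom_fin r hr0 hmomμ
  have Mν := mom_fin r hr0 hmomν
  have Mμk := fun k => mom_fin r hr0 (hmomμk k)
  have Mνk := fun k => mom_fin r hr0 (hmomνk k)
  obtain ⟨γ, γ1, γ2, γ3⟩ := exists_cpls r hr μk μ Mμk Mμ hWμ
  obtain ⟨η, η1, η2, η3⟩ := exists_cpls r hr νk ν Mνk Mν hWν
  have hex : ∀ k : ℕ, ∃ χ : Measure (ℝ × ℝ),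
      χ.map Prod.fst = (πk k).map Prod.fst ∧ χ.map Prod.snd = π.map Prod.fst ∧
      ∫ q, (|q.1 - q.2| ^ (1 : ℝ) + WrRpow 1 ((πk k).condKernel q.1) (π.condKernel q.2)) ∂χ <
        AWrRpow 1 (πk k) π + 1 / ((k : ℝ) + 1) := by
    intro k
    have hpos : (0 : ℝ) < 1 / ((k : ℝ) + 1) := by positivity
    obtain ⟨_, ⟨χ, a, b, rfl⟩, hlt⟩ := exists_lt_of_csInf_lt
      (s := {c : ℝ | ∃ χ : Measure (ℝ × ℝ),
        χ.map Prod.fst = (πk k).map Prod.fst ∧ χ.map Prod.snd = π.map Prod.fst ∧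
        c = ∫ q, (|q.1 - q.2| ^ (1 : ℝ) +
          WrRpow 1 ((πk k).condKernel q.1) (π.condKernel q.2)) ∂χ})
      ⟨_, γ k, by rw [γ1, hπk1], by rw [γ2, hπ1], rfl⟩
      (lt_add_of_pos_right (AWrRpow 1 (πk k) π) hpos)
    exact ⟨χ, a, b, hlt⟩
  choose χ χ1 χ2 χ3 using hex
  have χ1' : ∀ k, (χ k).map Prod.fst = μk k := fun k => by rw [χ1, hπk1]
  have χ2' : ∀ k, (χ k).map Prod.snd = μ := fun k => by rw [χ2, hπ1]
  have hχp : ∀ k, IsProbabilityMeasure (χ k) := fun k => prob_of_fst (χ1' k)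
  have hsum : ∀ k, ∫⁻ z, ‖z.1 - z.2‖ₑ ∂(χ k) + ∫⁻ z, ‖z.1 - z.2‖ₑ ∂(law (χ k) (πk k) π) ≤
      ENNReal.ofReal (AWrRpow 1 (πk k) π + 1 / ((k : ℝ) + 1)) := by
    intro k
    rw [← AW1_cost (χ k) (πk k) π (χ1 k) (χ2 k)
      (by rw [hπk1]; exact mom1_fin r hr (Mμk k)) (by rw [hπ1]; exact mom1_fin r hr Mμ)
      (by rw [hπk2]; exact mom1_fin r hr (Mνk k)) (by rw [hπ2]; exact mom1_fin r hr Mν)]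
    exact ENNReal.ofReal_le_ofReal (χ3 k).le
  have hlim : Tendsto (fun k : ℕ => ENNReal.ofReal (AWrRpow 1 (πk k) π + 1 / ((k : ℝ) + 1)))
      atTop (𝓝 0) := by
    have := ENNReal.tendsto_ofReal (hAW1.add tendsto_one_div_add_atTop_nhds_zero_nat)
    simpa using this
  have hX := core r hr μk μ Mμ γ χ γ1 γ2 χ1' χ2' γ3
    (tendsto_of_tendsto_of_tendsto_of_le_of_le tendsto_const_nhds hlim (fun _ => zero_le)
      (fun k => le_self_add.trans (hsum k)))
  have hY := core r hr νk ν Mν η (fun k => law (χ k) (πk k) π) η1 η2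
    (fun k => by rw [law_fst _ _ _ (χ1 k), hπk2]) (fun k => by rw [law_snd _ _ _ (χ2 k), hπ2]) η3
    (tendsto_of_tendsto_of_tendsto_of_le_of_le tendsto_const_nhds hlim (fun _ => zero_le)
      (fun k => le_add_self.trans (hsum k)))
  have hXY := hX.add hY
  rw [add_zero] at hXY
  have hfin : Tendsto (fun k => ENNReal.ofReal (AWrRpow r (πk k) π)) atTop (𝓝 0) :=
    tendsto_of_tendsto_of_tendsto_of_le_of_le tendsto_const_nhds hXY (fun _ => zero_le)
      (fun k => AW_le (χ k) (πk k) π r hr0 (χ1 k) (χ2 k))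
  have hnn : ∀ k, 0 ≤ AWrRpow r (πk k) π := by
    intro k
    refine Real.sInf_nonneg ?_
    rintro c ⟨χ', _, _, rfl⟩
    exact integral_nonneg fun q => add_nonneg (by positivity) (WrRpow_nonneg _ _ _)
  have hre : Tendsto (fun k => AWrRpow r (πk k) π) atTop (𝓝 0) := by
    have := (ENNReal.tendsto_toReal ENNReal.zero_ne_top).comp hfin
    refine this.congr fun k => ?_
    simp [ENNReal.toReal_ofReal (hnn k)]
  have := hre.rpow_const (p := 1 / r) (Or.inr (by positivity))
  rwa [Real.zero_rpow (by positivity)] at this
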